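/- Zehnder analytic approximation: for every f ∈ C^k(𝕋^d, sl(2,ℝ)) there exists a sequence (f_j)_{j≥1} with f_j analytic on the strip of width 1/j, such that ‖f_j − f‖_k → 0 as j → ∞, |f_j|_{1/j} ≤ C'‖f‖_k, and |f_{j+1} − f_j|_{1/(j+1)} ≤ C'(1/j)^k‖f‖_k, where C' is a universal constant independent of k and f. Consequently, for any n ≥ m, |f_n − f_m|_{1/n} ≤ 2C'(1/m)^{k−1}‖f‖_k (summing the geometric-type tail). -/

import Mathlib

open Real Complex Matrix Filter

noncomputable section

attribute [local instance] Matrix.linftyOpNormedAddCommGroup Matrix.linftyOpNormedRing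
  Matrix.linftyOpNormedAlgebra

/-- The `C^k` norm `sup_{|l| ≤ k, θ} ‖∂^l F(θ)‖` of a map on `ℝ^d`. -/
def CkNorm {E : Type*} [NormedAddCommGroup E] [NormedSpace ℝ E]
    (d k : ℕ) (f : (Fin d → ℝ) → E) : ℝ :=
  sSup {x | ∃ i : ℕ, i ≤ k ∧ ∃ θ : Fin d → ℝ, x = ‖iteratedFDeriv ℝ i f θ‖}

/-- The sup norm on the strip `{|Im θᵢ| < h}`. -/
def stripNormM (d : ℕ) (h : ℝ) (f : (Fin d → ℂ) → Matrix (Fin 2) (Fin 2) ℂ) : ℝ :=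
  sSup {x | ∃ θ : Fin d → ℂ, (∀ i, |(θ i).im| < h) ∧ x = ‖f θ‖}

section BandLimited

variable {d : ℕ} {E : Type*} [NormedAddCommGroup E] [NormedSpace ℂ E]

lemma norm_le_mul_exp_abs_im_of_bounded_on_real {h : ℂ → E} (hd : Differentiable ℂ h)
    {N C M : ℝ} (hC : ∀ z, ‖h z‖ ≤ C * Real.exp (N * |z.im|)) (hM : ∀ x : ℝ, ‖h x‖ ≤ M) (z : ℂ) :
    ‖h z‖ ≤ M * Real.exp (N * |z.im|) := by
  wlog hz : 0 ≤ z.im generalizing h z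
  · have := this (h := fun w => h (-w)) (hd.comp differentiable_neg)
      (fun w => by simpa using hC (-w)) (fun x => by simpa using hM (-x)) (-z)
      (by simpa using (not_le.1 hz).le)
    simpa using this
  let u : ℂ → E := fun w => Complex.exp (-(N * w)) • h (w * I)
  have hnorm : ∀ w, ‖u w‖ = Real.exp (-(N * w.re)) * ‖h (w * I)‖ := fun w => by
    simp [u, norm_smul, Complex.norm_exp]
  have hu : ∀ w : ℂ, 0 ≤ w.re → ‖u w‖ ≤ C := fun w hw => by
    have h1 := hC (w * I)
    rw [hnorm, Real.exp_neg, inv_mul_le_iff₀ (Real.exp_pos _), mul_comm _ C]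
    simpa [abs_of_nonneg hw] using h1
  have hud : Differentiable ℂ u :=
    (by fun_prop : Differentiable ℂ fun w : ℂ => Complex.exp (-(N * w))).smul
      (hd.comp (by fun_prop))
  have key : ‖u (z * -I)‖ ≤ M := by
    refine PhragmenLindelof.right_half_plane_of_bounded_on_real hud.diffContOnCl
      ⟨0, by norm_num, 0, ?_⟩ ?_ (fun x => ?_) (by simpa using hz)
    · refine Asymptotics.IsBigO.of_bound C ?_
      filter_upwards [mem_inf_of_right (mem_principal_self _)] with w hw
      simpa using hu w (le_of_lt hw)
    · refine isBoundedUnder_of_eventually_le (a := C) ?_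
      filter_upwards [eventually_ge_atTop 0] with x hx
      exact hu x (by simpa using hx)
    · rw [hnorm]
      have : (x : ℂ) * I * I = ((-x : ℝ) : ℂ) := by
        rw [mul_assoc, I_mul_I]; push_cast; ring
      rw [this]
      simpa using hM (-x)
  rw [hnorm, Real.exp_neg, inv_mul_le_iff₀ (Real.exp_pos _)] at key
  have e : z * -I * I = z := by rw [mul_assoc, neg_mul, I_mul_I]; simp
  rw [e] at key
  rw [mul_comm M, abs_of_nonneg hz]
  simpa using key

/-- Entire functions of exponential type at most `N` in the imaginary directions that are
`2π`-periodic in each coordinate. -/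
structure BandLimited (N : ℝ) (F : (Fin d → ℂ) → E) : Prop where
  differentiable : Differentiable ℂ F
  periodic : ∀ (θ : Fin d → ℂ) (m : Fin d → ℤ), F (θ + fun i => 2 * π * (m i : ℂ)) = F θ
  growth : ∃ C, ∀ z, ‖F z‖ ≤ C * Real.exp (N * ∑ i, |(z i).im|)

lemma BandLimited.mono {N N' : ℝ} {F : (Fin d → ℂ) → E} (hF : BandLimited N F) (h : N ≤ N') :
    BandLimited N' F := by
  obtain ⟨C, hC⟩ := hF.growth
  have hC0 : 0 ≤ C := by simpa using (norm_nonneg _).trans (hC 0)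
  exact ⟨hF.differentiable, hF.periodic, C, fun z => (hC z).trans (by gcongr)⟩

lemma BandLimited.zero (N : ℝ) : BandLimited N (0 : (Fin d → ℂ) → E) :=
  ⟨differentiable_const 0, fun _ _ => rfl, 0, by simp⟩

lemma BandLimited.add {N : ℝ} {F G : (Fin d → ℂ) → E} (hF : BandLimited N F)
    (hG : BandLimited N G) : BandLimited N (F + G) := by
  obtain ⟨C, hC⟩ := hF.growth
  obtain ⟨D, hD⟩ := hG.growth
  refine ⟨hF.differentiable.add hG.differentiable, fun θ m => ?_, C + D, fun z => ?_⟩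
  · simp only [Pi.add_apply, hF.periodic θ m, hG.periodic θ m]
  · rw [add_mul]
    exact (norm_add_le _ _).trans (add_le_add (hC z) (hD z))

lemma BandLimited.neg {N : ℝ} {F : (Fin d → ℂ) → E} (hF : BandLimited N F) :
    BandLimited N (-F) := by
  obtain ⟨C, hC⟩ := hF.growth
  exact ⟨hF.differentiable.neg, fun θ m => by simp only [Pi.neg_apply, hF.periodic θ m],
    C, fun z => by simpa using hC z⟩

lemma BandLimited.sum {ι : Type*} (s : Finset ι) {N : ℝ} {F : ι → (Fin d → ℂ) → E}
    (hF : ∀ q ∈ s, BandLimited N (F q)) : BandLimited N (∑ q ∈ s, F q) :=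
  Finset.sum_induction _ _ (fun _ _ => BandLimited.add) (BandLimited.zero N) hF

lemma BandLimited.exp_smul {N : ℝ} (m : Fin d → ℤ) (hm : ∀ i, |(m i : ℝ)| ≤ N) (a : E) :
    BandLimited N (fun z : Fin d → ℂ => Complex.exp (I * ∑ i, m i * z i) • a) := by
  refine ⟨by fun_prop, fun θ l => ?_, ‖a‖, fun z => ?_⟩
  · congr 1
    rw [Complex.exp_eq_exp_iff_exists_int]
    refine ⟨∑ i, m i * l i, ?_⟩
    simp only [Pi.add_apply, mul_add, Finset.sum_add_distrib]
    push_cast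
    simp only [Finset.sum_mul, Finset.mul_sum]
    congr 1
    exact Finset.sum_congr rfl fun i _ => by ring
  · rw [norm_smul, Complex.norm_exp, mul_comm]
    have e : (I * ∑ i, m i * z i).re = ∑ i, -(m i * (z i).im) := by
      simp [Complex.im_sum]
    rw [e, Finset.mul_sum]
    refine mul_le_mul_of_nonneg_left (Real.exp_le_exp.2 (Finset.sum_le_sum fun i _ => ?_))
      (norm_nonneg a)
    calc _ ≤ |(m i : ℝ) * (z i).im| := neg_le_abs _
      _ = |(m i : ℝ)| * |(z i).im| := abs_mul _ _
      _ ≤ _ := by gcongr; exact hm i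

lemma BandLimited.norm_le {N M : ℝ} {F : (Fin d → ℂ) → E} (hF : BandLimited N F)
    (hM : ∀ x : Fin d → ℝ, ‖F (fun i => (x i : ℂ))‖ ≤ M) (z : Fin d → ℂ) :
    ‖F z‖ ≤ M * Real.exp (N * ∑ i, |(z i).im|) := by
  obtain ⟨C, hC⟩ := hF.growth
  suffices ∀ s : Finset (Fin d), ∀ z : Fin d → ℂ, (∀ i ∉ s, (z i).im = 0) →
      ‖F z‖ ≤ M * Real.exp (N * ∑ i ∈ s, |(z i).im|) from
    this Finset.univ z (by simp)
  intro s
  induction s using Finset.induction_on with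
  | empty =>
    intro z hz
    have : z = fun i => (((z i).re : ℝ) : ℂ) := by
      ext i
      exact Complex.ext rfl (by simpa using hz i (by simp))
    rw [this]
    simpa using hM _
  | insert a s ha ih =>
    intro z hz
    have hsum : ∀ w, ∑ i ∈ s, |(Function.update z a w i).im| = ∑ i ∈ s, |(z i).im| := fun w =>
      Finset.sum_congr rfl fun i hi => by
        rw [Function.update_of_ne (by rintro rfl; exact ha hi)]
    have hsplit : ∀ w, ∑ i, |(Function.update z a w i).im| = |w.im| + ∑ i ∈ s, |(z i).im| :=
      fun w => by
        rw [← hsum w, ← Finset.sum_subset (Finset.subset_univ (insert a s)),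
          Finset.sum_insert ha, Function.update_self]
        intro i _ hi
        rw [Function.update_of_ne (by rintro rfl; simp at hi), hz i hi, abs_zero]
    have := norm_le_mul_exp_abs_im_of_bounded_on_real (h := fun w => F (Function.update z a w))
      (hF.differentiable.comp (differentiable_pi.2 fun i => ?_)) (N := N)
      (C := C * Real.exp (N * ∑ i ∈ s, |(z i).im|))
      (M := M * Real.exp (N * ∑ i ∈ s, |(z i).im|)) (fun w => ?_) (fun x => ?_) (z a)
    · rw [Function.update_eq_self] at this
      rwa [Finset.sum_insert ha, add_comm, mul_add, Real.exp_add, ← mul_assoc]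
    · by_cases h : i = a
      · subst h; simp
      · simp [Function.update_of_ne h]
    · have := hC (Function.update z a w)
      rwa [hsplit, add_comm, mul_add, Real.exp_add, ← mul_assoc] at this
    · rw [← hsum x]
      refine ih _ fun i hi => ?_
      by_cases h : i = a
      · subst h; simp
      · rw [Function.update_of_ne h]; exact hz i (by simp [h, hi])

end BandLimited

open MeasureTheory in
/-- The average of the translates of `g` against `μ`. -/
def translateAverage {d : ℕ} {E : Type*} [NormedAddCommGroup E] [NormedSpace ℝ E]
    (μ : Measure (Fin d → ℝ)) (g : (Fin d → ℝ) → E) (x : Fin d → ℝ) : E :=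
  ∫ t, g (x - t) ∂μ

open MeasureTheory in
/-- The error committed when `g` is replaced by its average `translateAverage μ g`. -/
def averageDefect {d : ℕ} {E : Type*} [NormedAddCommGroup E] [NormedSpace ℝ E]
    (μ : Measure (Fin d → ℝ)) (g : (Fin d → ℝ) → E) (x : Fin d → ℝ) : E :=
  g x - translateAverage μ g x

/-- `2π`-periodicity in each coordinate. -/
def LatticePeriodic {d : ℕ} {E : Type*} (g : (Fin d → ℝ) → E) : Prop :=
  ∀ (θ : Fin d → ℝ) (m : Fin d → ℤ), g (θ + fun i => 2 * π * m i) = g θ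

section Periodic

variable {d : ℕ} {E : Type*} [NormedAddCommGroup E]

lemma exists_lattice_translate_norm_le (x : Fin d → ℝ) :
    ∃ m : Fin d → ℤ, ‖x + fun i => 2 * π * (m i : ℝ)‖ ≤ 2 * π := by
  refine ⟨fun i => -⌊x i / (2 * π)⌋, (pi_norm_le_iff_of_nonneg (by positivity)).2 fun i => ?_⟩
  have hpi : 0 < 2 * π := by positivity
  have h1 := Int.floor_le (x i / (2 * π))
  have h2 := Int.lt_floor_add_one (x i / (2 * π))
  rw [le_div_iff₀ hpi] at h1
  rw [div_lt_iff₀ hpi] at h2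
  simp only [Pi.add_apply, Real.norm_eq_abs, Int.cast_neg]
  rw [abs_le]
  constructor <;> nlinarith

lemma LatticePeriodic.exists_norm_le {g : (Fin d → ℝ) → E} (hg : LatticePeriodic g)
    (hc : Continuous g) : ∃ B, ∀ x, ‖g x‖ ≤ B := by
  obtain ⟨B, hB⟩ := (isCompact_closedBall (0 : Fin d → ℝ) (2 * π)).exists_bound_of_continuousOn
    hc.continuousOn
  refine ⟨B, fun x => ?_⟩
  obtain ⟨m, hm⟩ := exists_lattice_translate_norm_le x
  rw [← hg x m]
  exact hB _ (by simpa using hm)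

lemma LatticePeriodic.exists_dist_le {g : (Fin d → ℝ) → E} (hg : LatticePeriodic g)
    (hc : Continuous g) {η : ℝ} (hη : 0 < η) :
    ∃ δ > 0, ∀ x t, ‖t‖ < δ → ‖g x - g (x - t)‖ ≤ η := by
  have hu := (isCompact_closedBall (0 : Fin d → ℝ) (2 * π + 1)).uniformContinuousOn_of_continuous
    hc.continuousOn
  obtain ⟨δ, hδ, h⟩ := Metric.uniformContinuousOn_iff.1 hu η hη
  refine ⟨min δ 1, by positivity, fun x t ht => ?_⟩
  obtain ⟨m, hm⟩ := exists_lattice_translate_norm_le x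
  rw [← hg x m, ← hg (x - t) m, ← dist_eq_norm]
  set v : Fin d → ℝ := fun i => 2 * π * (m i : ℝ)
  have e : x - t + v = (x + v) - t := by abel
  rw [e]
  refine (h _ ?_ _ ?_ ?_).le
  · simpa using hm.trans (by linarith)
  · have := norm_sub_le (x + v) t
    have := ht.trans_le (min_le_right δ 1)
    rw [mem_closedBall_zero_iff]
    linarith
  · simpa [dist_eq_norm] using ht.trans_le (min_le_left δ 1)

variable [NormedSpace ℝ E]

lemma LatticePeriodic.periodic_iteratedFDeriv {g : (Fin d → ℝ) → E} (hg : LatticePeriodic g)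
    (i : ℕ) : LatticePeriodic (iteratedFDeriv ℝ i g) := by
  intro θ m
  rw [← iteratedFDeriv_comp_add_right]
  simp only [hg _ m]

lemma LatticePeriodic.periodic_fderiv {g : (Fin d → ℝ) → E} (hg : LatticePeriodic g) :
    LatticePeriodic (fderiv ℝ g) := by
  intro θ m
  rw [← fderiv_comp_add_right]
  simp only [hg _ m]

end Periodic

section Average

open MeasureTheory

variable {d : ℕ} {E : Type*} [NormedAddCommGroup E] {μ : Measure (Fin d → ℝ)}

lemma LatticePeriodic.integrable_comp_sub [IsProbabilityMeasure μ] {g : (Fin d → ℝ) → E}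
    (hg : LatticePeriodic g) (hc : Continuous g) (x : Fin d → ℝ) :
    Integrable (fun t => g (x - t)) μ := by
  obtain ⟨B, hB⟩ := hg.exists_norm_le hc
  exact Integrable.of_bound (by fun_prop) B (.of_forall fun t => hB _)

variable [NormedSpace ℝ E]

lemma LatticePeriodic.periodic_translateAverage {g : (Fin d → ℝ) → E} (hg : LatticePeriodic g) :
    LatticePeriodic (translateAverage μ g) := by
  intro θ m
  simp only [translateAverage, add_sub_right_comm, hg _ m]

lemma LatticePeriodic.periodic_averageDefect {g : (Fin d → ℝ) → E} (hg : LatticePeriodic g) :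
    LatticePeriodic (averageDefect μ g) := by
  intro θ m
  simp only [averageDefect, hg θ m, hg.periodic_translateAverage θ m]

variable [IsProbabilityMeasure μ]

lemma LatticePeriodic.hasFDerivAt_translateAverage {g : (Fin d → ℝ) → E} (hg : LatticePeriodic g)
    (h1 : ContDiff ℝ 1 g) (x : Fin d → ℝ) :
    HasFDerivAt (translateAverage μ g) (translateAverage μ (fderiv ℝ g) x)
      x := by
  have hc' : Continuous (fderiv ℝ g) := h1.continuous_fderiv one_ne_zero
  obtain ⟨B, hB⟩ := hg.periodic_fderiv.exists_norm_le hc'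
  have hc := h1.continuous
  refine hasFDerivAt_integral_of_dominated_of_fderiv_le (s := Set.univ) (bound := fun _ => B)
    (F := fun x t => g (x - t)) (F' := fun x t => fderiv ℝ g (x - t))
    Filter.univ_mem (.of_forall fun y => ?_)
    (hg.integrable_comp_sub hc x) ?_
    (.of_forall fun t y _ => hB _) (integrable_const B) (.of_forall fun t y _ => ?_)
  · exact (hg.integrable_comp_sub hc y).1
  · exact (hg.periodic_fderiv.integrable_comp_sub hc' x).1
  · exact ((h1.differentiable one_ne_zero (y - t)).hasFDerivAt).comp y
      ((hasFDerivAt_id y).sub_const t)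

lemma LatticePeriodic.iteratedFDeriv_translateAverage [CompleteSpace E] {g : (Fin d → ℝ) → E}
    (hg : LatticePeriodic g) {i k : ℕ} (hk : ContDiff ℝ k g) (hi : i ≤ k) :
    iteratedFDeriv ℝ i (translateAverage μ g) =
      translateAverage μ (iteratedFDeriv ℝ i g) := by
  induction i with
  | zero =>
    ext1 x
    simp only [iteratedFDeriv_zero_eq_comp, Function.comp, translateAverage]
    exact ((continuousMultilinearCurryFin0 ℝ (Fin d → ℝ) E).symm.toContinuousLinearEquiv
      |>.integral_comp_comm _).symm
  | succ i ih =>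
    have h1 : ContDiff ℝ 1 (iteratedFDeriv ℝ i g) :=
      hk.iteratedFDeriv_right (by norm_cast; omega)
    ext1 x
    rw [iteratedFDeriv_succ_eq_comp_left, ih (by omega), Function.comp_apply,
      ((hg.periodic_iteratedFDeriv i).hasFDerivAt_translateAverage h1 x).fderiv,
      iteratedFDeriv_succ_eq_comp_left]
    exact (ContinuousLinearEquiv.integral_comp_comm (𝕜 := ℝ) (μ := μ)
      (E := (Fin d → ℝ) →L[ℝ] ((Fin d → ℝ) [×i]→L[ℝ] E)) (F := (Fin d → ℝ) [×i + 1]→L[ℝ] E)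
      (continuousMultilinearCurryLeftEquiv ℝ (fun _ : Fin (i + 1) => Fin d → ℝ)
        E).symm.toContinuousLinearEquiv _).symm

lemma LatticePeriodic.contDiff_translateAverage [CompleteSpace E] {g : (Fin d → ℝ) → E}
    (hg : LatticePeriodic g) {k : ℕ} (hk : ContDiff ℝ k g) :
    ContDiff ℝ k (translateAverage μ g) := by
  refine contDiff_nat_iff_continuous_differentiable.2 ⟨fun i hi => ?_, fun i hi => ?_⟩
  · rw [hg.iteratedFDeriv_translateAverage hk hi]
    have hc : Continuous (iteratedFDeriv ℝ i g) :=
      hk.continuous_iteratedFDeriv (by exact_mod_cast hi)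
    obtain ⟨B, hB⟩ := (hg.periodic_iteratedFDeriv i).exists_norm_le hc
    exact continuous_of_dominated
      (fun x => ((hg.periodic_iteratedFDeriv i).integrable_comp_sub hc x).1)
      (fun x => .of_forall fun t => hB _) (integrable_const B) (.of_forall fun t => by fun_prop)
  · rw [hg.iteratedFDeriv_translateAverage hk hi.le]
    exact fun x => ((hg.periodic_iteratedFDeriv i).hasFDerivAt_translateAverage
      (hk.iteratedFDeriv_right (by norm_cast; omega)) x).differentiableAt

lemma LatticePeriodic.contDiff_averageDefect [CompleteSpace E] {g : (Fin d → ℝ) → E}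
    (hg : LatticePeriodic g) {k : ℕ} (hk : ContDiff ℝ k g) :
    ContDiff ℝ k (averageDefect μ g) :=
  hk.sub (hg.contDiff_translateAverage hk)

lemma LatticePeriodic.iteratedFDeriv_averageDefect [CompleteSpace E] {g : (Fin d → ℝ) → E}
    (hg : LatticePeriodic g) {i k : ℕ} (hk : ContDiff ℝ k g) (hi : i ≤ k) :
    iteratedFDeriv ℝ i (averageDefect μ g) =
      averageDefect μ (iteratedFDeriv ℝ i g) := by
  have hk' : ContDiff ℝ i g := hk.of_le (by exact_mod_cast hi)
  have : averageDefect μ g = g - translateAverage μ g := rfl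
  rw [this, iteratedFDeriv_sub hk' (hg.contDiff_translateAverage hk'),
    hg.iteratedFDeriv_translateAverage hk hi]
  rfl

lemma LatticePeriodic.averageDefect_eq_integral [CompleteSpace E] {g : (Fin d → ℝ) → E}
    (hg : LatticePeriodic g) (hc : Continuous g) (x : Fin d → ℝ) :
    averageDefect μ g x = ∫ t, (g x - g (x - t)) ∂μ := by
  rw [integral_sub (integrable_const _) (hg.integrable_comp_sub hc x)]
  simp [averageDefect, translateAverage]

lemma LatticePeriodic.norm_averageDefect_le_of_norm_sub_le [CompleteSpace E]
    {g : (Fin d → ℝ) → E} (hg : LatticePeriodic g) (hc : Continuous g) {a b ε : ℝ}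
    (hb : 0 ≤ b) (hμ : Integrable (fun t => ‖t‖) μ) (hε : ∫ t, ‖t‖ ∂μ ≤ ε) (x : Fin d → ℝ)
    (h : ∀ t, ‖g x - g (x - t)‖ ≤ a + b * ‖t‖) :
    ‖averageDefect μ g x‖ ≤ a + b * ε := by
  rw [hg.averageDefect_eq_integral hc]
  calc _ ≤ ∫ t, (a + b * ‖t‖) ∂μ :=
        norm_integral_le_of_norm_le ((integrable_const a).add (hμ.const_mul b)) (.of_forall h)
    _ = a + b * ∫ t, ‖t‖ ∂μ := by
        rw [integral_add (integrable_const a) (hμ.const_mul b), integral_const_mul]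
        simp
    _ ≤ _ := by gcongr

lemma LatticePeriodic.norm_averageDefect_le_of_norm_fderiv_le [CompleteSpace E]
    {g : (Fin d → ℝ) → E} (hg : LatticePeriodic g) (h1 : ContDiff ℝ 1 g) {M ε : ℝ}
    (hμ : Integrable (fun t => ‖t‖) μ) (hε : ∫ t, ‖t‖ ∂μ ≤ ε)
    (hM : ∀ x, ‖fderiv ℝ g x‖ ≤ M) (x : Fin d → ℝ) :
    ‖averageDefect μ g x‖ ≤ ε * M := by
  have hM0 : 0 ≤ M := (norm_nonneg _).trans (hM x)
  have := hg.norm_averageDefect_le_of_norm_sub_le h1.continuous (a := 0) hM0 hμ hε x fun t => by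
    have := convex_univ.norm_image_sub_le_of_norm_fderiv_le (𝕜 := ℝ) (f := g)
      (fun y _ => h1.differentiable one_ne_zero y) (fun y _ => hM y) (Set.mem_univ (x - t))
      (Set.mem_univ x)
    simpa using this
  linarith

lemma LatticePeriodic.norm_averageDefect_le_two_mul [CompleteSpace E]
    {g : (Fin d → ℝ) → E} (hg : LatticePeriodic g) (hc : Continuous g) {M : ℝ}
    (hM : ∀ x, ‖g x‖ ≤ M) (x : Fin d → ℝ) :
    ‖averageDefect μ g x‖ ≤ 2 * M := by
  rw [hg.averageDefect_eq_integral hc]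
  refine (norm_integral_le_of_norm_le (integrable_const (2 * M)) (.of_forall fun t => ?_)).trans
    (by simp)
  linarith [norm_sub_le (g x) (g (x - t)), hM x, hM (x - t)]

lemma LatticePeriodic.iterate_averageDefect [CompleteSpace E] {g : (Fin d → ℝ) → E}
    (hg : LatticePeriodic g) {k : ℕ} (hk : ContDiff ℝ k g) (l : ℕ) :
    LatticePeriodic ((averageDefect μ)^[l] g) ∧
      ContDiff ℝ k ((averageDefect μ)^[l] g) := by
  induction l with
  | zero => exact ⟨hg, hk⟩
  | succ l ih =>
    rw [Function.iterate_succ_apply']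
    exact ⟨ih.1.periodic_averageDefect, ih.1.contDiff_averageDefect ih.2⟩

lemma LatticePeriodic.norm_iteratedFDeriv_iterate_averageDefect_le [CompleteSpace E]
    {g : (Fin d → ℝ) → E} (hg : LatticePeriodic g) {k : ℕ} (hk : ContDiff ℝ k g) {M ε : ℝ}
    (hμ : Integrable (fun t => ‖t‖) μ) (hε : ∫ t, ‖t‖ ∂μ ≤ ε)
    (hM : ∀ i ≤ k, ∀ x, ‖iteratedFDeriv ℝ i g x‖ ≤ M) {i l : ℕ} (hil : i + l ≤ k)
    (x : Fin d → ℝ) :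
    ‖iteratedFDeriv ℝ i ((averageDefect μ)^[l] g) x‖ ≤ ε ^ l * M := by
  induction l generalizing i x with
  | zero => simpa using hM i hil x
  | succ l ih =>
    obtain ⟨hp, hd⟩ := hg.iterate_averageDefect (μ := μ) hk l
    rw [Function.iterate_succ_apply', hp.iteratedFDeriv_averageDefect hd (by omega), pow_succ',
      mul_assoc]
    refine (hp.periodic_iteratedFDeriv i).norm_averageDefect_le_of_norm_fderiv_le
      (hd.iteratedFDeriv_right (by norm_cast; omega)) hμ hε (fun y => ?_) x
    rw [norm_fderiv_iteratedFDeriv]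
    exact ih (by omega) y

lemma LatticePeriodic.norm_iteratedFDeriv_iterate_averageDefect_le_two_pow [CompleteSpace E]
    {g : (Fin d → ℝ) → E} (hg : LatticePeriodic g) {k : ℕ} (hk : ContDiff ℝ k g) {M : ℝ} {i : ℕ}
    (hi : i ≤ k) (hM : ∀ x, ‖iteratedFDeriv ℝ i g x‖ ≤ M) (l : ℕ) (x : Fin d → ℝ) :
    ‖iteratedFDeriv ℝ i ((averageDefect μ)^[l] g) x‖ ≤ 2 ^ l * M := by
  induction l generalizing x with
  | zero => simpa using hM x
  | succ l ih =>
    obtain ⟨hp, hd⟩ := hg.iterate_averageDefect (μ := μ) hk l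
    rw [Function.iterate_succ_apply', hp.iteratedFDeriv_averageDefect hd hi, pow_succ',
      mul_assoc]
    exact (hp.periodic_iteratedFDeriv i).norm_averageDefect_le_two_mul
      (hd.continuous_iteratedFDeriv (by exact_mod_cast hi)) ih x

end Average

lemma LatticePeriodic.eventually_norm_iteratedFDeriv_iterate_averageDefect_le
    {d : ℕ} {E : Type*} [NormedAddCommGroup E] [NormedSpace ℝ E] [CompleteSpace E]
    {g : (Fin d → ℝ) → E} (hg : LatticePeriodic g) {k : ℕ} (hk : ContDiff ℝ k g)
    {μ : ℕ → MeasureTheory.Measure (Fin d → ℝ)} [∀ j, MeasureTheory.IsProbabilityMeasure (μ j)]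
    {ε : ℕ → ℝ} (hμ : ∀ j, MeasureTheory.Integrable (fun t => ‖t‖) (μ j))
    (hε : ∀ j, ∫ t, ‖t‖ ∂(μ j) ≤ ε j) (hε0 : Tendsto ε atTop (nhds 0)) {i l : ℕ} (hi : i ≤ k)
    (hl : 1 ≤ l) {η : ℝ} (hη : 0 < η) :
    ∀ᶠ j in atTop, ∀ x, ‖iteratedFDeriv ℝ i ((averageDefect (μ j))^[l] g) x‖ ≤ η := by
  obtain ⟨l, rfl⟩ := Nat.exists_eq_add_of_le' hl
  have hc : Continuous (iteratedFDeriv ℝ i g) :=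
    hk.continuous_iteratedFDeriv (by exact_mod_cast hi)
  set η' : ℝ := η / 2 ^ (l + 1) with hη'
  have hη'0 : 0 < η' := by positivity
  obtain ⟨B, hB⟩ := (hg.periodic_iteratedFDeriv i).exists_norm_le hc
  have hB0 : 0 ≤ B := (norm_nonneg _).trans (hB 0)
  obtain ⟨δ, hδ, hδ'⟩ := (hg.periodic_iteratedFDeriv i).exists_dist_le hc hη'0
  have hlim : Tendsto (fun j => 2 * B / δ * ε j) atTop (nhds 0) := by
    simpa using hε0.const_mul (2 * B / δ)
  filter_upwards [hlim.eventually (eventually_le_nhds hη'0)] with j hj x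
  rw [Function.iterate_succ_apply]
  refine (hg.periodic_averageDefect.norm_iteratedFDeriv_iterate_averageDefect_le_two_pow
    (hg.contDiff_averageDefect hk) hi (M := 2 * η') (fun y => ?_) l x).trans_eq ?_
  · rw [hg.iteratedFDeriv_averageDefect hk hi]
    refine ((hg.periodic_iteratedFDeriv i).norm_averageDefect_le_of_norm_sub_le hc (a := η')
      (b := 2 * B / δ) (by positivity) (hμ j) (hε j) y fun t => ?_).trans (by linarith)
    by_cases ht : ‖t‖ < δ
    · exact (hδ' y t ht).trans (le_add_of_nonneg_right (by positivity))
    · have h2 : 2 * B ≤ 2 * B / δ * ‖t‖ := by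
        rw [div_mul_eq_mul_div, le_div_iff₀ hδ]
        exact mul_le_mul_of_nonneg_left (not_lt.1 ht) (by positivity)
      linarith [norm_sub_le (iteratedFDeriv ℝ i g y) (iteratedFDeriv ℝ i g (y - t)),
        hB y, hB (y - t)]
  · rw [hη']
    field_simp
    ring

section Kernel

open MeasureTheory

/-- The exponential sum `∑_{k < n} e^{ikt}`. -/
def expSum (n : ℕ) (t : ℝ) : ℂ := ∑ k ∈ Finset.range n, Complex.exp (I * t) ^ k

/-- The Jackson kernel, a normalized fourth power of the Dirichlet kernel. -/
def jacksonKernel (n : ℕ) (t : ℝ) : ℝ :=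
  ‖expSum n t‖ ^ 4 / ∫ s in -π..π, ‖expSum n s‖ ^ 4

@[fun_prop]
lemma continuous_expSum (n : ℕ) : Continuous (expSum n) := by
  unfold expSum
  fun_prop

@[fun_prop]
lemma continuous_jacksonKernel (n : ℕ) : Continuous (jacksonKernel n) := by
  unfold jacksonKernel
  fun_prop

lemma norm_expSum_le (n : ℕ) (t : ℝ) : ‖expSum n t‖ ≤ n := by
  refine (norm_sum_le _ _).trans (le_of_eq ?_)
  simp [Complex.norm_exp]

lemma abs_mul_norm_expSum_le (n : ℕ) {t : ℝ} (ht : |t| ≤ π) : |t| * ‖expSum n t‖ ≤ π := by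
  have h1 : ‖expSum n t‖ * ‖Complex.exp (I * t) - 1‖ ≤ 2 := by
    rw [← norm_mul, expSum, geom_sum_mul]
    refine (norm_sub_le _ _).trans (le_of_eq ?_)
    norm_num [Complex.norm_exp]
  have h2 : 2 / π * |t| ≤ ‖Complex.exp (I * t) - 1‖ := by
    rw [Complex.norm_exp_I_mul_ofReal_sub_one, norm_mul, Real.norm_eq_abs, Real.norm_eq_abs]
    have := Real.mul_abs_le_abs_sin (x := t / 2) (by rw [abs_div, abs_two]; linarith)
    rw [abs_div, abs_two] at this
    rw [abs_two]
    linarith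
  have h3 : ‖expSum n t‖ * (2 / π * |t|) ≤ 2 := (by gcongr : _ ≤ _).trans h1
  have e : ‖expSum n t‖ * (2 / π * |t|) = 2 * (|t| * ‖expSum n t‖) / π := by ring
  rw [e, div_le_iff₀ Real.pi_pos] at h3
  linarith

lemma half_le_norm_expSum {n : ℕ} {t : ℝ} (ht : n * |t| ≤ 1) : (n : ℝ) / 2 ≤ ‖expSum n t‖ := by
  refine le_trans ?_ (Complex.re_le_norm _)
  have hk : ∀ k ∈ Finset.range n, (1 : ℝ) / 2 ≤ (Complex.exp (I * t) ^ k).re := fun k hk => by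
    have e : Complex.exp (I * t) ^ k = Complex.exp ((k * t : ℝ) * I) := by
      rw [← Complex.exp_nat_mul]
      push_cast
      ring_nf
    rw [e, Complex.exp_ofReal_mul_I_re]
    have h1 := Real.one_sub_sq_div_two_le_cos (x := k * t)
    have h2 : (k : ℝ) * |t| ≤ 1 := by
      refine le_trans ?_ ht
      gcongr
      exact (Finset.mem_range.1 hk).le
    have h3 : (k * t : ℝ) ^ 2 ≤ 1 := by
      rw [sq_le_one_iff_abs_le_one, abs_mul, Nat.abs_cast]
      exact h2
    linarith
  rw [expSum, Complex.re_sum]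
  refine le_trans (le_of_eq ?_) (Finset.sum_le_sum hk)
  simp
  ring

lemma le_integral_norm_expSum_pow_four {n : ℕ} (hn : 1 ≤ n) :
    (n : ℝ) ^ 3 / 8 ≤ ∫ s in -π..π, ‖expSum n s‖ ^ 4 := by
  have hn' : (1 : ℝ) ≤ n := by exact_mod_cast hn
  have hinv : (1 : ℝ) / n ≤ π := by
    rw [div_le_iff₀ (by positivity)]
    nlinarith [Real.pi_gt_three]
  have hpos : (0 : ℝ) < 1 / n := by positivity
  calc (n : ℝ) ^ 3 / 8 = ∫ s in -(1 / n : ℝ)..(1 / n : ℝ), ((n : ℝ) / 2) ^ 4 := by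
        rw [intervalIntegral.integral_const, smul_eq_mul]
        field_simp
        ring
    _ ≤ ∫ s in -(1 / n : ℝ)..(1 / n : ℝ), ‖expSum n s‖ ^ 4 := by
        refine intervalIntegral.integral_mono_on (by linarith) (by simp)
          (Continuous.intervalIntegrable (by fun_prop) _ _) fun s hs => ?_
        gcongr
        refine half_le_norm_expSum ?_
        rw [mul_comm, ← le_div_iff₀ (by positivity)]
        exact abs_le.2 hs
    _ ≤ _ := by
        refine intervalIntegral.integral_mono_interval (by linarith) (by linarith) hinv
          (.of_forall fun s => by positivity) (Continuous.intervalIntegrable (by fun_prop) _ _)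

lemma integral_sq_mul_norm_expSum_pow_four_le {n : ℕ} (hn : 1 ≤ n) :
    ∫ s in -π..π, s ^ 2 * ‖expSum n s‖ ^ 4 ≤ π ^ 3 * (1 + π ^ 2) * n := by
  have hn' : (0 : ℝ) < n := by exact_mod_cast hn
  have hpi := Real.pi_pos
  calc ∫ s in -π..π, s ^ 2 * ‖expSum n s‖ ^ 4
      ≤ ∫ s in -π..π, (π ^ 2 * (1 + π ^ 2) * n ^ 2) * (1 + (n * s) ^ 2)⁻¹ := by
        refine intervalIntegral.integral_mono_on (by linarith)
          (Continuous.intervalIntegrable (by fun_prop) _ _)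
          (Continuous.intervalIntegrable ?_ _ _) fun s hs => ?_
        · exact continuous_const.mul (Continuous.inv₀ (by fun_prop) fun s => by positivity)
        · have h1 := norm_expSum_le n s
          have h2 := abs_mul_norm_expSum_le n (abs_le.2 hs)
          have h3 : ‖expSum n s‖ ^ 2 ≤ n ^ 2 := by gcongr
          have h4 : s ^ 2 * ‖expSum n s‖ ^ 2 ≤ π ^ 2 := by
            rw [← sq_abs s, ← mul_pow]
            gcongr
          rw [← div_eq_mul_inv, le_div_iff₀ (by positivity)]
          calc s ^ 2 * ‖expSum n s‖ ^ 4 * (1 + (n * s) ^ 2)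
              = (s ^ 2 * ‖expSum n s‖ ^ 2) *
                (‖expSum n s‖ ^ 2 + n ^ 2 * (s ^ 2 * ‖expSum n s‖ ^ 2)) := by ring
            _ ≤ π ^ 2 * (n ^ 2 + n ^ 2 * π ^ 2) := by gcongr
            _ = _ := by ring
    _ = π ^ 2 * (1 + π ^ 2) * n * (2 * Real.arctan (n * π)) := by
        rw [intervalIntegral.integral_const_mul,
          intervalIntegral.integral_comp_mul_left (fun x => (1 + x ^ 2)⁻¹) hn'.ne',
          integral_inv_one_add_sq, mul_neg, Real.arctan_neg, smul_eq_mul]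
        field_simp
        ring
    _ ≤ π ^ 2 * (1 + π ^ 2) * n * (2 * (π / 2)) := by
        gcongr
        exact (Real.arctan_lt_pi_div_two _).le
    _ = _ := by ring

lemma jacksonKernel_nonneg (n : ℕ) (t : ℝ) : 0 ≤ jacksonKernel n t :=
  div_nonneg (by positivity) (intervalIntegral.integral_nonneg (by linarith [Real.pi_pos])
    fun s _ => by positivity)

lemma integral_jacksonKernel {n : ℕ} (hn : 1 ≤ n) : ∫ t in -π..π, jacksonKernel n t = 1 := by
  have h := le_integral_norm_expSum_pow_four hn
  have hn' : (1 : ℝ) ≤ n := by exact_mod_cast hn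
  have : (0 : ℝ) < n ^ 3 / 8 := by positivity
  simp only [jacksonKernel]
  rw [intervalIntegral.integral_div, div_self (by linarith)]

lemma integral_abs_mul_jacksonKernel_le {n : ℕ} (hn : 1 ≤ n) :
    ∫ t in -π..π, |t| * jacksonKernel n t ≤ (1 + 8 * (π ^ 3 * (1 + π ^ 2))) / n := by
  have h := le_integral_norm_expSum_pow_four hn
  have h2 := integral_sq_mul_norm_expSum_pow_four_le hn
  have hn' : (0 : ℝ) < n := by exact_mod_cast hn
  have hpi := Real.pi_pos
  set Z := ∫ s in -π..π, ‖expSum n s‖ ^ 4 with hZ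
  have hZ0 : 0 < Z := lt_of_lt_of_le (by positivity) h
  have e : ∀ t, |t| * jacksonKernel n t = |t| * ‖expSum n t‖ ^ 4 / Z := fun t => by
    rw [jacksonKernel, mul_div_assoc]
  simp only [e]
  rw [intervalIntegral.integral_div, div_le_iff₀ hZ0]
  calc ∫ t in -π..π, |t| * ‖expSum n t‖ ^ 4
      ≤ ∫ t in -π..π, (1 / n * ‖expSum n t‖ ^ 4 + n * (t ^ 2 * ‖expSum n t‖ ^ 4)) := by
        refine intervalIntegral.integral_mono_on (by linarith)
          (Continuous.intervalIntegrable (by fun_prop) _ _)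
          (Continuous.intervalIntegrable (by fun_prop) _ _) fun t _ => ?_
        have : |t| ≤ 1 / n + n * t ^ 2 := by
          have e : 1 / n + n * t ^ 2 = (1 + (n * |t|) ^ 2) / n := by
            rw [mul_pow, sq_abs]
            field_simp
          rw [e, le_div_iff₀ hn']
          nlinarith [sq_nonneg (n * |t| - 1), mul_nonneg hn'.le (abs_nonneg t)]
        calc _ ≤ (1 / n + n * t ^ 2) * ‖expSum n t‖ ^ 4 := by gcongr
          _ = _ := by ring
    _ = 1 / n * Z + n * ∫ t in -π..π, t ^ 2 * ‖expSum n t‖ ^ 4 := by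
        rw [intervalIntegral.integral_add (Continuous.intervalIntegrable (by fun_prop) _ _)
          (Continuous.intervalIntegrable (by fun_prop) _ _), intervalIntegral.integral_const_mul,
          intervalIntegral.integral_const_mul]
    _ ≤ 1 / n * Z + n * (π ^ 3 * (1 + π ^ 2) * n) := by gcongr
    _ = 1 / n * Z + 8 * (π ^ 3 * (1 + π ^ 2)) / n * (n ^ 3 / 8) := by
        field_simp
    _ ≤ 1 / n * Z + 8 * (π ^ 3 * (1 + π ^ 2)) / n * Z := by gcongr
    _ = _ := by ring

lemma ofReal_norm_expSum_pow_four (n : ℕ) (t : ℝ) :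
    ((‖expSum n t‖ ^ 4 : ℝ) : ℂ) = ∑ q : (Fin n × Fin n) × (Fin n × Fin n),
      Complex.exp (I * ((((q.1.1 : ℤ) + q.1.2 - (q.2.1 + q.2.2) : ℤ) : ℂ) * t)) := by
  have h1 : expSum n t = ∑ k : Fin n, Complex.exp (I * (k * t)) := by
    rw [expSum, Finset.sum_range]
    refine Finset.sum_congr rfl fun k _ => ?_
    rw [← Complex.exp_nat_mul]
    ring_nf
  have h2 : (starRingEnd ℂ) (expSum n t) = ∑ k : Fin n, Complex.exp (-(I * (k * t))) := by
    rw [h1, map_sum]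
    refine Finset.sum_congr rfl fun k _ => ?_
    rw [← Complex.exp_conj]
    simp
  have h3 : ((‖expSum n t‖ ^ 4 : ℝ) : ℂ) = (expSum n t * expSum n t) *
      ((starRingEnd ℂ) (expSum n t) * (starRingEnd ℂ) (expSum n t)) := by
    have := Complex.mul_conj' (expSum n t)
    push_cast
    linear_combination (-(‖expSum n t‖ : ℂ) ^ 2 - expSum n t * (starRingEnd ℂ) (expSum n t)) * this
  rw [h3, h2, h1]
  simp only [Finset.sum_mul_sum, ← Finset.sum_product', Finset.univ_product_univ]
  refine Finset.sum_congr rfl fun q _ => ?_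
  simp only [← Complex.exp_add]
  congr 1
  push_cast
  ring

end Kernel

section PeriodBox

open MeasureTheory

/-- The half-open cube of side `2π` with lower corner `a`. -/
def periodBox {d : ℕ} (a : Fin d → ℝ) : Set (Fin d → ℝ) :=
  Set.univ.pi fun i => Set.Ioc (a i) (a i + 2 * π)

lemma measurableSet_periodBox {d : ℕ} (a : Fin d → ℝ) : MeasurableSet (periodBox a) :=
  MeasurableSet.univ_pi fun _ => measurableSet_Ioc

/-- The embedding of `ℤ^d` in `ℝ^d` as the period lattice `2πℤ^d`. -/
def latticeHom (d : ℕ) : (Fin d → ℤ) →+ (Fin d → ℝ) where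
  toFun m i := 2 * π * m i
  map_zero' := by ext; simp
  map_add' m l := by ext; simp [mul_add]

lemma latticeHom_vadd_apply {d : ℕ} (m : Fin d → ℤ) (x : Fin d → ℝ) (i : Fin d) :
    ((⟨latticeHom d m, m, rfl⟩ : (latticeHom d).range) +ᵥ x) i = 2 * π * m i + x i :=
  rfl

lemma isAddFundamentalDomain_periodBox {d : ℕ} (a : Fin d → ℝ) :
    IsAddFundamentalDomain (latticeHom d).range (periodBox a) := by
  refine IsAddFundamentalDomain.mk' (measurableSet_periodBox a).nullMeasurableSet fun x => ?_
  choose m hm hu using fun i => existsUnique_add_zsmul_mem_Ioc Real.two_pi_pos (x i) (a i)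
  refine ⟨⟨latticeHom d m, m, rfl⟩, fun i _ => ?_, ?_⟩
  · rw [latticeHom_vadd_apply, add_comm, mul_comm (2 * π), ← zsmul_eq_mul]
    exact hm i
  · rintro ⟨_, l, rfl⟩ hl
    have : l = m := by
      ext i
      refine hu i (l i) ?_
      have := hl i trivial
      rwa [latticeHom_vadd_apply, add_comm, mul_comm (2 * π), ← zsmul_eq_mul] at this
    simp [this]

lemma LatticePeriodic.setIntegral_periodBox_comp_sub {d : ℕ} {E : Type*} [NormedAddCommGroup E]
    [NormedSpace ℝ E] {g : (Fin d → ℝ) → E} (hg : LatticePeriodic g) (a x : Fin d → ℝ) :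
    ∫ t in periodBox a, g (x - t) = ∫ t in periodBox a, g (-t) := by
  have : Countable (latticeHom d).range := (Set.countable_range (latticeHom d)).to_subtype
  have hpre : (fun t => t - x) ⁻¹' periodBox (a - x) = periodBox a := by
    ext t
    simp [periodBox, sub_add_eq_add_sub]
  have hneg : ∀ (v : (latticeHom d).range) t, g (-(v +ᵥ t)) = g (-t) := by
    rintro ⟨_, m, rfl⟩ t
    rw [← hg (-t) (-m)]
    congr 1
    ext i
    simp only [Pi.neg_apply, Pi.add_apply, latticeHom_vadd_apply]
    push_cast
    ring
  calc ∫ t in periodBox a, g (x - t)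
      = ∫ t in (fun t => t - x) ⁻¹' periodBox (a - x), g (-(t - x)) := by simp [hpre]
    _ = ∫ t in periodBox (a - x), g (-t) :=
        (measurePreserving_sub_right volume x).setIntegral_preimage_emb
          (measurableEmbedding_subRight x) (fun t => g (-t)) _
    _ = _ := (isAddFundamentalDomain_periodBox (a - x)).setIntegral_eq
        (isAddFundamentalDomain_periodBox a) hneg

end PeriodBox

section JacksonMeasure

open MeasureTheory

/-- The probability measure on the cube `(-π, π]^d` whose density is a product of Jackson
kernels. -/
def jacksonMeasure (d n : ℕ) : Measure (Fin d → ℝ) :=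
  (volume.restrict (periodBox fun _ => -π)).withDensity
    fun t => ENNReal.ofReal (∏ i, jacksonKernel n (t i))

lemma volume_restrict_periodBox (d : ℕ) :
    (volume : Measure (Fin d → ℝ)).restrict (periodBox fun _ => -π) =
      Measure.pi fun _ => (volume : Measure ℝ).restrict (Set.Ioc (-π) π) := by
  rw [volume_pi, periodBox, Measure.restrict_pi_pi]
  ring_nf

lemma prod_jacksonKernel_nonneg {d : ℕ} (n : ℕ) (t : Fin d → ℝ) :
    0 ≤ ∏ i, jacksonKernel n (t i) :=
  Finset.prod_nonneg fun _ _ => jacksonKernel_nonneg n _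

lemma integral_jacksonMeasure {d : ℕ} (n : ℕ) {E : Type*} [NormedAddCommGroup E]
    [NormedSpace ℝ E] (h : (Fin d → ℝ) → E) :
    ∫ t, h t ∂(jacksonMeasure d n) =
      ∫ t in periodBox fun _ => -π, (∏ i, jacksonKernel n (t i)) • h t := by
  rw [jacksonMeasure, integral_withDensity_eq_integral_toReal_smul (by fun_prop) (by simp)]
  simp only [ENNReal.toReal_ofReal (prod_jacksonKernel_nonneg n _)]

lemma setIntegral_jacksonKernel {n : ℕ} (hn : 1 ≤ n) :
    ∫ t in Set.Ioc (-π) π, jacksonKernel n t = 1 := by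
  rw [← intervalIntegral.integral_of_le (by linarith [Real.pi_pos]), integral_jacksonKernel hn]

lemma isProbabilityMeasure_jacksonMeasure {d n : ℕ} (hn : 1 ≤ n) :
    IsProbabilityMeasure (jacksonMeasure d n) := by
  constructor
  have hint : Integrable (fun t : Fin d → ℝ => ∏ i, jacksonKernel n (t i))
      (Measure.pi fun _ => (volume : Measure ℝ).restrict (Set.Ioc (-π) π)) :=
    Integrable.fintype_prod (fun i => (continuous_jacksonKernel n).integrableOn_Ioc)
  rw [jacksonMeasure, withDensity_apply _ MeasurableSet.univ, Measure.restrict_univ,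
    volume_restrict_periodBox, ← ofReal_integral_eq_lintegral_ofReal hint
      (.of_forall (prod_jacksonKernel_nonneg n)),
    integral_fintype_prod_eq_prod (fun _ => jacksonKernel n)]
  simp [setIntegral_jacksonKernel hn]

lemma integrable_norm_jacksonMeasure {d n : ℕ} (hn : 1 ≤ n) :
    Integrable (fun t => ‖t‖) (jacksonMeasure d n) := by
  have := isProbabilityMeasure_jacksonMeasure (d := d) hn
  refine Integrable.of_bound (by fun_prop) π ?_
  refine (withDensity_absolutelyContinuous _ _).ae_le ?_
  filter_upwards [ae_restrict_mem (measurableSet_periodBox _)] with t ht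
  rw [norm_norm, pi_norm_le_iff_of_nonneg Real.pi_pos.le]
  intro i
  have := ht i trivial
  rw [Real.norm_eq_abs, abs_le]
  exact ⟨this.1.le, by linarith [this.2]⟩

lemma integral_abs_apply_jacksonMeasure {d n : ℕ} (hn : 1 ≤ n) (i : Fin d) :
    ∫ t, |t i| ∂(jacksonMeasure d n) = ∫ t in -π..π, |t| * jacksonKernel n t := by
  have e : ∀ t : Fin d → ℝ, (∏ j, jacksonKernel n (t j)) • |t i| =
      ∏ j, (if j = i then |t j| else 1) * jacksonKernel n (t j) := fun t => by
    rw [Finset.prod_mul_distrib, Finset.prod_ite_eq' Finset.univ i]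
    simp [mul_comm]
  rw [integral_jacksonMeasure, volume_restrict_periodBox]
  simp only [e]
  rw [integral_fintype_prod_eq_prod
    (fun j s => (if j = i then |s| else 1) * jacksonKernel n s),
    Finset.prod_eq_single i, intervalIntegral.integral_of_le (by linarith [Real.pi_pos])]
  · simp
  · intro j _ hj
    simp [hj, setIntegral_jacksonKernel hn]
  · simp

lemma integral_norm_jacksonMeasure_le {d n : ℕ} (hn : 1 ≤ n) :
    ∫ t, ‖t‖ ∂(jacksonMeasure d n) ≤ d * ((1 + 8 * (π ^ 3 * (1 + π ^ 2))) / n) := by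
  have hint : ∀ i, Integrable (fun t : Fin d → ℝ => |t i|) (jacksonMeasure d n) := fun i =>
    (integrable_norm_jacksonMeasure hn).mono' (continuous_apply i).abs.aestronglyMeasurable
      (.of_forall fun t => by simpa using norm_le_pi_norm t i)
  calc ∫ t, ‖t‖ ∂(jacksonMeasure d n) ≤ ∫ t, ∑ i, |t i| ∂(jacksonMeasure d n) := by
        refine integral_mono (integrable_norm_jacksonMeasure hn)
          (integrable_finsetSum _ fun i _ => hint i) fun t => ?_
        exact (pi_norm_le_iff_of_nonneg (Finset.sum_nonneg fun i _ => abs_nonneg _)).2 fun i =>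
          Finset.single_le_sum (f := fun i => |t i|) (fun i _ => abs_nonneg _) (Finset.mem_univ i)
    _ = ∑ i : Fin d, ∫ t in -π..π, |t| * jacksonKernel n t := by
        rw [integral_finsetSum _ fun i _ => hint i]
        exact Finset.sum_congr rfl fun i _ => integral_abs_apply_jacksonMeasure hn i
    _ ≤ _ := by
        rw [Finset.sum_const, Finset.card_univ, Fintype.card_fin, nsmul_eq_mul]
        gcongr
        exact integral_abs_mul_jacksonKernel_le hn

lemma prod_jacksonKernel_eq_sum (d n : ℕ) :
    ∃ (ι : Type) (_ : Fintype ι) (m : ι → Fin d → ℤ) (c : ℂ),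
      (∀ q i, |(m q i : ℝ)| ≤ 2 * n) ∧
      ∀ t : Fin d → ℝ, ((∏ i, jacksonKernel n (t i) : ℝ) : ℂ) =
        ∑ q, c * Complex.exp (I * ∑ i, (m q i : ℂ) * (t i : ℂ)) := by
  refine ⟨Fin d → (Fin n × Fin n) × (Fin n × Fin n), inferInstance,
    fun q i => ((q i).1.1 : ℤ) + (q i).1.2 - ((q i).2.1 + (q i).2.2),
    (((∫ s in -π..π, ‖expSum n s‖ ^ 4 : ℝ) : ℂ)⁻¹) ^ d, fun q i => ?_, fun t => ?_⟩
  · have h : |((q i).1.1 : ℤ) + (q i).1.2 - ((q i).2.1 + (q i).2.2)| ≤ 2 * n := by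
      rw [abs_le]
      have := (q i).1.1.isLt
      have := (q i).1.2.isLt
      have := (q i).2.1.isLt
      have := (q i).2.2.isLt
      constructor <;> omega
    exact_mod_cast h
  · have e : ∀ i, ((jacksonKernel n (t i) : ℝ) : ℂ) =
        ((∫ s in -π..π, ‖expSum n s‖ ^ 4 : ℝ) : ℂ)⁻¹ * ((‖expSum n (t i)‖ ^ 4 : ℝ) : ℂ) :=
      fun i => by rw [jacksonKernel, Complex.ofReal_div, div_eq_inv_mul]
    rw [Complex.ofReal_prod, Finset.prod_congr rfl fun i _ => e i, Finset.prod_mul_distrib,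
      Finset.prod_const, Finset.card_univ, Fintype.card_fin, ← Finset.mul_sum]
    congr 1
    simp only [ofReal_norm_expSum_pow_four, Finset.prod_univ_sum, Fintype.piFinset_univ,
      ← Complex.exp_sum, Finset.mul_sum]

variable {d : ℕ} {E : Type*} [NormedAddCommGroup E] [NormedSpace ℝ E] [NormedSpace ℂ E]
  [IsScalarTower ℝ ℂ E]

lemma LatticePeriodic.exists_bandLimited_translateAverage {g : (Fin d → ℝ) → E}
    (hg : LatticePeriodic g) (hc : Continuous g) (n : ℕ) :
    ∃ G : (Fin d → ℂ) → E, BandLimited (2 * n) G ∧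
      ∀ x : Fin d → ℝ, G (fun i => (x i : ℂ)) = translateAverage (jacksonMeasure d n) g x := by
  obtain ⟨ι, _, m, c, hm, hK⟩ := prod_jacksonKernel_eq_sum d n
  let u : ι → (Fin d → ℝ) → E := fun q s => Complex.exp (-(I * ∑ i, (m q i : ℂ) * (s i : ℂ))) • g s
  have huc : ∀ q, Continuous (u q) := fun q => by fun_prop
  have hu : ∀ q, LatticePeriodic (u q) := fun q θ l => by
    simp only [u, hg θ l]
    congr 1
    rw [Complex.exp_eq_exp_iff_exists_int]
    refine ⟨-∑ i, m q i * l i, ?_⟩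
    simp only [Pi.add_apply, Complex.ofReal_add, mul_add, Finset.sum_add_distrib]
    push_cast
    simp only [neg_mul, Finset.sum_mul, Finset.mul_sum, neg_add]
    congr 2
    exact Finset.sum_congr rfl fun i _ => by ring
  refine ⟨∑ q, fun z => Complex.exp (I * ∑ i, m q i * z i) •
      (c • ∫ t in periodBox fun _ => -π, u q (-t)),
    BandLimited.sum _ fun q _ => BandLimited.exp_smul (m q) (hm q) _, fun x => ?_⟩
  have hint : ∀ q, IntegrableOn (fun t => u q (x - t)) (periodBox fun _ => -π) := fun q => by
    have : IsFiniteMeasure ((volume : Measure (Fin d → ℝ)).restrict (periodBox fun _ => -π)) := by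
      rw [volume_restrict_periodBox]
      infer_instance
    obtain ⟨B, hB⟩ := (hu q).exists_norm_le (huc q)
    exact Integrable.of_bound (by fun_prop) B (.of_forall fun t => hB _)
  rw [translateAverage, integral_jacksonMeasure, Finset.sum_apply]
  calc _ = ∑ q, ∫ t in periodBox fun _ => -π,
        (Complex.exp (I * ∑ i, (m q i : ℂ) * (x i : ℂ)) * c) • u q (x - t) := by
        refine Finset.sum_congr rfl fun q _ => ?_
        rw [smul_smul, ← (hu q).setIntegral_periodBox_comp_sub _ x, ← integral_smul]
    _ = ∫ t in periodBox fun _ => -π, ∑ q,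
        (Complex.exp (I * ∑ i, (m q i : ℂ) * (x i : ℂ)) * c) • u q (x - t) :=
        (integral_finsetSum _ fun q _ => (hint q).smul _).symm
    _ = _ := by
        refine integral_congr_ae (.of_forall fun t => ?_)
        simp only [u]
        rw [← algebraMap_smul ℂ (∏ i, jacksonKernel n (t i)) (g (x - t)),
          Complex.coe_algebraMap, hK, Finset.sum_smul]
        refine Finset.sum_congr rfl fun q _ => ?_
        rw [smul_smul, mul_right_comm, ← Complex.exp_add, mul_comm c]
        congr 3
        simp only [Pi.sub_apply, Complex.ofReal_sub, mul_sub, Finset.sum_sub_distrib]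
        ring

lemma LatticePeriodic.exists_bandLimited_sub_iterate_averageDefect [CompleteSpace E]
    {g : (Fin d → ℝ) → E} (hg : LatticePeriodic g) (hc : Continuous g) {n : ℕ} (hn : 1 ≤ n)
    (l : ℕ) :
    ∃ G : (Fin d → ℂ) → E, BandLimited (2 * n) G ∧ ∀ x : Fin d → ℝ,
      G (fun i => (x i : ℂ)) = g x - (averageDefect (jacksonMeasure d n))^[l] g x := by
  have := isProbabilityMeasure_jacksonMeasure (d := d) hn
  induction l with
  | zero => exact ⟨0, BandLimited.zero _, by simp⟩
  | succ l ih =>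
    obtain ⟨G, hG, hG'⟩ := ih
    obtain ⟨hp, hd⟩ := hg.iterate_averageDefect (μ := jacksonMeasure d n) (k := 0)
      (contDiff_zero.2 hc) l
    obtain ⟨H, hH, hH'⟩ := hp.exists_bandLimited_translateAverage hd.continuous n
    refine ⟨G + H, hG.add hH, fun x => ?_⟩
    rw [Pi.add_apply, hG', hH', Function.iterate_succ_apply']
    simp only [averageDefect]
    abel

end JacksonMeasure

section Approximation

open MeasureTheory

variable {d : ℕ}

/-- A ratio between bandwidth and inverse strip width which makes the first absolute moment of
the Jackson measures at most the strip width. -/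
def bandwidthRatio (d : ℕ) : ℕ := ⌈d * (1 + 8 * (π ^ 3 * (1 + π ^ 2)))⌉₊ + 1

/-- The Jackson measure used for the approximation on the strip of width `1 / j`, for `j ≥ 1`. -/
def stripMeasure (d j : ℕ) : Measure (Fin d → ℝ) := jacksonMeasure d (bandwidthRatio d * max j 1)

lemma one_le_bandwidthRatio_mul (d j : ℕ) : 1 ≤ bandwidthRatio d * max j 1 :=
  Nat.one_le_iff_ne_zero.2 (Nat.mul_ne_zero (Nat.succ_ne_zero _) (by omega))

instance isProbabilityMeasure_stripMeasure (d j : ℕ) : IsProbabilityMeasure (stripMeasure d j) :=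
  isProbabilityMeasure_jacksonMeasure (one_le_bandwidthRatio_mul d j)

lemma integrable_norm_stripMeasure (d j : ℕ) : Integrable (fun t => ‖t‖) (stripMeasure d j) :=
  integrable_norm_jacksonMeasure (one_le_bandwidthRatio_mul d j)

lemma integral_norm_stripMeasure_le (d j : ℕ) :
    ∫ t, ‖t‖ ∂(stripMeasure d j) ≤ 1 / (max j 1 : ℕ) := by
  refine (integral_norm_jacksonMeasure_le (one_le_bandwidthRatio_mul d j)).trans ?_
  have hj : (0 : ℝ) < (max j 1 : ℕ) := by exact_mod_cast (by omega : 0 < max j 1)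
  have ha : (d * (1 + 8 * (π ^ 3 * (1 + π ^ 2))) : ℝ) ≤ bandwidthRatio d := by
    refine (Nat.le_ceil _).trans ?_
    rw [bandwidthRatio]
    exact_mod_cast Nat.le_succ _
  have ha0 : (0 : ℝ) < bandwidthRatio d := by exact_mod_cast Nat.succ_pos _
  rw [Nat.cast_mul, mul_div_assoc', div_le_div_iff₀ (by positivity) hj, one_mul]
  exact mul_le_mul_of_nonneg_right ha hj.le

lemma tendsto_one_div_max_one :
    Tendsto (fun j : ℕ => (1 : ℝ) / (max j 1 : ℕ)) atTop (nhds 0) :=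
  tendsto_one_div_atTop_nhds_zero_nat.congr' <| by
    filter_upwards [eventually_ge_atTop 1] with j hj
    rw [max_eq_left hj]

lemma BandLimited.norm_le_of_abs_im_lt {E : Type*} [NormedAddCommGroup E] [NormedSpace ℂ E]
    {a n M : ℝ} {F : (Fin d → ℂ) → E} (hF : BandLimited (a * n) F) (ha : 0 ≤ a) (hn : 0 < n)
    (hM : ∀ x : Fin d → ℝ, ‖F (fun i => (x i : ℂ))‖ ≤ M) {z : Fin d → ℂ}
    (hz : ∀ i, |(z i).im| < 1 / n) : ‖F z‖ ≤ M * Real.exp (a * d) := by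
  have hM0 : 0 ≤ M := (norm_nonneg _).trans (hM 0)
  refine (hF.norm_le hM z).trans (mul_le_mul_of_nonneg_left (Real.exp_le_exp.2 ?_) hM0)
  calc a * n * ∑ i, |(z i).im| ≤ a * n * ∑ _i : Fin d, 1 / n := by
        gcongr with i
        exact (hz i).le
    _ = a * d := by
        rw [Finset.sum_const, Finset.card_univ, Fintype.card_fin, nsmul_eq_mul]
        field_simp

variable {E : Type*} [NormedAddCommGroup E] [NormedSpace ℝ E]

lemma LatticePeriodic.iterate_averageDefect_mem [CompleteSpace E] {μ : Measure (Fin d → ℝ)}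
    [IsProbabilityMeasure μ] {g : (Fin d → ℝ) → E} (hg : LatticePeriodic g) (hc : Continuous g)
    {S : Submodule ℝ E} (hS : IsClosed (S : Set E)) (h : ∀ x, g x ∈ S) (l : ℕ) (x : Fin d → ℝ) :
    (averageDefect μ)^[l] g x ∈ S := by
  induction l generalizing x with
  | zero => exact h x
  | succ l ih =>
    obtain ⟨hp, hd⟩ := hg.iterate_averageDefect (μ := μ) (k := 0) (contDiff_zero.2 hc) l
    rw [Function.iterate_succ_apply']
    exact S.sub_mem (ih x) (S.convex.integral_mem hS (.of_forall fun t => ih (x - t))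
      (hp.integrable_comp_sub hd.continuous x))

end Approximation

lemma LatticePeriodic.bddAbove_CkNorm {d : ℕ} {E : Type*} [NormedAddCommGroup E]
    [NormedSpace ℝ E] {g : (Fin d → ℝ) → E} (hg : LatticePeriodic g) {k : ℕ}
    (hk : ContDiff ℝ k g) :
    BddAbove {x | ∃ i : ℕ, i ≤ k ∧ ∃ θ : Fin d → ℝ, x = ‖iteratedFDeriv ℝ i g θ‖} := by
  have hB : ∀ i : ℕ, ∃ B, i ≤ k → ∀ θ, ‖iteratedFDeriv ℝ i g θ‖ ≤ B := fun i => by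
    by_cases hi : i ≤ k
    · obtain ⟨B, hB⟩ := (hg.periodic_iteratedFDeriv i).exists_norm_le
        (hk.continuous_iteratedFDeriv (by exact_mod_cast hi))
      exact ⟨B, fun _ => hB⟩
    · exact ⟨0, fun h => absurd h hi⟩
  choose B hB using hB
  refine ⟨∑ i ∈ Finset.range (k + 1), |B i|, ?_⟩
  rintro _ ⟨i, hi, θ, rfl⟩
  exact ((hB i hi θ).trans (le_abs_self _)).trans
    (Finset.single_le_sum (fun i _ => abs_nonneg (B i)) (Finset.mem_range.2 (by omega)))

lemma LatticePeriodic.norm_iteratedFDeriv_le_CkNorm {d : ℕ} {E : Type*} [NormedAddCommGroup E]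
    [NormedSpace ℝ E] {g : (Fin d → ℝ) → E} (hg : LatticePeriodic g) {k : ℕ}
    (hk : ContDiff ℝ k g) {i : ℕ} (hi : i ≤ k) (θ : Fin d → ℝ) :
    ‖iteratedFDeriv ℝ i g θ‖ ≤ CkNorm d k g :=
  le_csSup (hg.bddAbove_CkNorm hk) ⟨i, hi, θ, rfl⟩

lemma CkNorm_nonneg {E : Type*} [NormedAddCommGroup E] [NormedSpace ℝ E] (d k : ℕ)
    (g : (Fin d → ℝ) → E) : 0 ≤ CkNorm d k g :=
  Real.sSup_nonneg (by rintro _ ⟨i, _, θ, rfl⟩; exact norm_nonneg _)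

lemma CkNorm_neg {E : Type*} [NormedAddCommGroup E] [NormedSpace ℝ E] (d k : ℕ)
    (g : (Fin d → ℝ) → E) : CkNorm d k (-g) = CkNorm d k g := by
  simp only [CkNorm, iteratedFDeriv_neg, Pi.neg_apply, norm_neg]

lemma tendsto_CkNorm_iterate_averageDefect {d : ℕ} {E : Type*} [NormedAddCommGroup E]
    [NormedSpace ℝ E] [CompleteSpace E] {g : (Fin d → ℝ) → E} (hg : LatticePeriodic g) {k : ℕ}
    (hk : ContDiff ℝ k g) (hk1 : 1 ≤ k) :
    Tendsto (fun j => CkNorm d k ((averageDefect (stripMeasure d j))^[k] g)) atTop (nhds 0) := by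
  refine Metric.tendsto_atTop'.2 fun η hη => ?_
  have h : ∀ᶠ j in atTop, ∀ i ∈ Finset.range (k + 1), ∀ x,
      ‖iteratedFDeriv ℝ i ((averageDefect (stripMeasure d j))^[k] g) x‖ ≤ η / 2 :=
    (Filter.eventually_all_finset _).2 fun i hi =>
      hg.eventually_norm_iteratedFDeriv_iterate_averageDefect_le hk
        (integrable_norm_stripMeasure d) (integral_norm_stripMeasure_le d)
        tendsto_one_div_max_one (by simpa [Nat.lt_succ_iff] using hi) hk1 (by positivity)
  obtain ⟨N, hN⟩ := eventually_atTop.1 h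
  refine ⟨N, fun j hj => ?_⟩
  rw [dist_zero_right, Real.norm_eq_abs, abs_of_nonneg (CkNorm_nonneg _ _ _)]
  refine lt_of_le_of_lt (Real.sSup_le ?_ (half_pos hη).le) (half_lt_self hη)
  rintro _ ⟨i, hi, θ, rfl⟩
  exact hN j hj.le i (Finset.mem_range.2 (by omega)) θ

/-- Entrywise complexification of real matrices, as an isometry for the `ℓ^∞` operator norm. -/
def complexifyMatrix : Matrix (Fin 2) (Fin 2) ℝ →ₗᵢ[ℝ] Matrix (Fin 2) (Fin 2) ℂ where
  toFun B := B.map (fun x => (x : ℂ))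
  map_add' A B := by ext; simp
  map_smul' c A := by ext; simp
  norm_map' A := by
    change ‖A.map (fun x => (x : ℂ))‖ = ‖A‖
    simp only [Matrix.linfty_opNorm_def, Matrix.map_apply, Complex.nnnorm_real]

/-- The image of `sl(2, ℝ)` in the complex matrices. -/
def realTraceless : Submodule ℝ (Matrix (Fin 2) (Fin 2) ℂ) :=
  (LinearMap.ker (Matrix.traceLinearMap (Fin 2) ℝ ℝ)).map complexifyMatrix.toLinearMap

lemma stripNormM_le {d : ℕ} {h B : ℝ} {F : (Fin d → ℂ) → Matrix (Fin 2) (Fin 2) ℂ} (hB : 0 ≤ B)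
    (hF : ∀ θ, (∀ i, |(θ i).im| < h) → ‖F θ‖ ≤ B) : stripNormM d h F ≤ B :=
  Real.sSup_le (by rintro _ ⟨θ, hθ, rfl⟩; exact hF θ hθ) hB

/-- Zehnder analytic approximation: every `f ∈ C^k(𝕋^d, sl(2,ℝ))` admits a sequence of
analytic approximants `F j` on strips of width `1/j`, real sl(2,ℝ)-valued and periodic on
the real torus, with `‖F j - f‖_k → 0`, `|F j|_{1/j} ≤ C'‖f‖_k`,
`|F (j+1) - F j|_{1/(j+1)} ≤ C'(1/j)^k ‖f‖_k`, and consequently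
`|F n - F m|_{1/n} ≤ 2C'(1/m)^{k-1}‖f‖_k` for `n ≥ m`; `C'` is universal. -/
theorem stmt_9 (d : ℕ) (hd : 1 ≤ d) :
    ∃ C' : ℝ, 0 < C' ∧
      ∀ (k : ℕ), 1 ≤ k →
      ∀ f : (Fin d → ℝ) → Matrix (Fin 2) (Fin 2) ℝ,
        ContDiff ℝ k f →
        (∀ (θ : Fin d → ℝ) (m : Fin d → ℤ), f (θ + fun i => 2 * π * m i) = f θ) →
        (∀ θ, (f θ).trace = 0) →
        ∃ F : ℕ → (Fin d → ℂ) → Matrix (Fin 2) (Fin 2) ℂ,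
          (∀ j : ℕ, 1 ≤ j →
            DifferentiableOn ℂ (F j) {θ : Fin d → ℂ | ∀ i, |(θ i).im| < 1 / j} ∧
            (∀ θ : Fin d → ℝ, ∃ B : Matrix (Fin 2) (Fin 2) ℝ, B.trace = 0 ∧
              F j (fun i => (θ i : ℂ)) = B.map (fun x => (x : ℂ))) ∧
            (∀ (θ : Fin d → ℂ) (m : Fin d → ℤ),
              F j (θ + fun i => 2 * π * (m i : ℂ)) = F j θ)) ∧
          Tendsto (fun j : ℕ =>
            CkNorm d k (fun θ : Fin d → ℝ =>
              F j (fun i => (θ i : ℂ)) - (f θ).map (fun x => (x : ℂ)))) atTop (nhds 0) ∧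
          (∀ j : ℕ, 1 ≤ j → stripNormM d (1 / j) (F j) ≤ C' * CkNorm d k f) ∧
          (∀ j : ℕ, 1 ≤ j →
            stripNormM d (1 / (j + 1)) (fun θ => F (j + 1) θ - F j θ) ≤
              C' * (1 / j) ^ k * CkNorm d k f) ∧
          (∀ m n : ℕ, 1 ≤ m → m ≤ n →
            stripNormM d (1 / n) (fun θ => F n θ - F m θ) ≤
              2 * C' * (1 / m) ^ (k - 1) * CkNorm d k f) := by
  set a : ℝ := 2 * bandwidthRatio d with ha
  have ha0 : 0 ≤ a := by positivity
  refine ⟨2 * Real.exp (a * d), by positivity, fun k hk f hf hper htr => ?_⟩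
  set M := CkNorm d k f with hMdef
  have hM0 : 0 ≤ M := CkNorm_nonneg d k f
  set g : (Fin d → ℝ) → Matrix (Fin 2) (Fin 2) ℂ := complexifyMatrix ∘ f with hg
  have hgp : LatticePeriodic g := fun θ m => congrArg complexifyMatrix (hper θ m)
  have hgk : ContDiff ℝ k g := complexifyMatrix.toContinuousLinearMap.contDiff.comp hf
  have hgM : ∀ i ≤ k, ∀ x, ‖iteratedFDeriv ℝ i g x‖ ≤ M := fun i hi x => by
    rw [hg, complexifyMatrix.norm_iteratedFDeriv_comp_left hf.contDiffAt (by exact_mod_cast hi)]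
    exact LatticePeriodic.norm_iteratedFDeriv_le_CkNorm hper hf hi x
  have hgS : ∀ x, g x ∈ realTraceless := fun x => ⟨f x, by simp [htr], rfl⟩
  have hS : IsClosed (realTraceless : Set (Matrix (Fin 2) (Fin 2) ℂ)) :=
    realTraceless.closed_of_finiteDimensional
  choose F hF hFg using fun j => hgp.exists_bandLimited_sub_iterate_averageDefect hgk.continuous
    (one_le_bandwidthRatio_mul d j) k
  change ∀ j x, _ = g x - (averageDefect (stripMeasure d j))^[k] g x at hFg
  have hR : ∀ j : ℕ, 1 ≤ j → ∀ x, ‖(averageDefect (stripMeasure d j))^[k] g x‖ ≤ (1 / j) ^ k * M :=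
    fun j hj x => by
      have := hgp.norm_iteratedFDeriv_iterate_averageDefect_le hgk
        (integrable_norm_stripMeasure d j) (integral_norm_stripMeasure_le d j) hgM
        (i := 0) (l := k) (by simp) x
      rwa [norm_iteratedFDeriv_zero, max_eq_left hj] at this
  have hFN : ∀ j n : ℕ, 1 ≤ n → j ≤ n → BandLimited (a * n) (F j) := fun j n hn hjn =>
    (hF j).mono <| by
      rw [ha, mul_assoc]
      have : max j 1 ≤ n := max_le hjn hn
      exact_mod_cast Nat.mul_le_mul_left 2 (Nat.mul_le_mul_left _ this)
  have hle1 : ∀ m : ℕ, 1 ≤ m → (1 : ℝ) / m ≤ 1 := fun m hm => by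
    rw [div_le_one (by exact_mod_cast hm)]
    exact_mod_cast hm
  have hdiff : ∀ m n : ℕ, 1 ≤ m → m ≤ n →
      stripNormM d (1 / n) (fun θ => F n θ - F m θ) ≤ 2 * Real.exp (a * d) * (1 / m) ^ k * M := by
    intro m n hm hmn
    have hm' : (0 : ℝ) < m := by exact_mod_cast hm
    have hn' : (0 : ℝ) < n := by exact_mod_cast hm.trans hmn
    refine stripNormM_le (by positivity) fun θ hθ => ?_
    have hband : BandLimited (a * n) (F n + -F m) :=
      (hFN n n (hm.trans hmn) le_rfl).add (hFN m n (hm.trans hmn) hmn).neg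
    have := hband.norm_le_of_abs_im_lt ha0 hn' (M := 2 * ((1 / m) ^ k * M)) (fun x => ?_) hθ
    · rw [sub_eq_add_neg]
      refine this.trans_eq ?_
      ring
    · have e : (F n + -F m) (fun i => (x i : ℂ)) =
          (averageDefect (stripMeasure d m))^[k] g x -
            (averageDefect (stripMeasure d n))^[k] g x := by
        rw [Pi.add_apply, Pi.neg_apply, hFg, hFg]
        abel
      have hpow : ((1 : ℝ) / n) ^ k * M ≤ (1 / m) ^ k * M := by gcongr
      rw [e]
      linarith [norm_sub_le ((averageDefect (stripMeasure d m))^[k] g x)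
        ((averageDefect (stripMeasure d n))^[k] g x), hR m hm x, hR n (hm.trans hmn) x]
  refine ⟨F, fun j hj => ⟨(hF j).differentiable.differentiableOn, fun θ => ?_, (hF j).periodic⟩,
    ?_, fun j hj => ?_, fun j hj => ?_, fun m n hm hmn => ?_⟩
  · obtain ⟨B, hB, hB'⟩ : F j (fun i => (θ i : ℂ)) ∈ realTraceless := by
      rw [hFg]
      exact realTraceless.sub_mem (hgS θ)
        (hgp.iterate_averageDefect_mem (μ := stripMeasure d j) hgk.continuous hS hgS k θ)
    exact ⟨B, by simpa using hB, hB'.symm⟩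
  · refine (tendsto_CkNorm_iterate_averageDefect hgp hgk hk).congr fun j => ?_
    rw [← CkNorm_neg]
    congr 1
    ext1 θ
    rw [hFg]
    simp only [Pi.neg_apply, hg, Function.comp_apply]
    exact (sub_sub_cancel_left _ _).symm
  · have hj' : (0 : ℝ) < j := by exact_mod_cast hj
    refine stripNormM_le (by positivity) fun θ hθ => ?_
    have := (hFN j j hj le_rfl).norm_le_of_abs_im_lt ha0 hj' (M := 2 * M) (fun x => ?_) hθ
    · exact this.trans_eq (by ring)
    · have h0 := hgM 0 (Nat.zero_le k) x
      rw [norm_iteratedFDeriv_zero] at h0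
      have hpow : ((1 : ℝ) / j) ^ k * M ≤ M :=
        mul_le_of_le_one_left hM0 (pow_le_one₀ (by positivity) (hle1 j hj))
      rw [hFg]
      linarith [norm_sub_le (g x) ((averageDefect (stripMeasure d j))^[k] g x), hR j hj x]
  · simpa using hdiff j (j + 1) hj (Nat.le_succ j)
  · refine (hdiff m n hm hmn).trans ?_
    have hpow : ((1 : ℝ) / m) ^ k ≤ (1 / m) ^ (k - 1) :=
      pow_le_pow_of_le_one (by positivity) (hle1 m hm) (Nat.sub_le k 1)
    calc 2 * Real.exp (a * d) * (1 / m) ^ k * M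
        ≤ 2 * Real.exp (a * d) * (1 / m) ^ (k - 1) * M := by gcongr
      _ ≤ 2 * (2 * Real.exp (a * d)) * (1 / m) ^ (k - 1) * M := by
        gcongr
        linarith [Real.exp_pos (a * d)]
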